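/- arXiv:2105.04753 — 3 statements merged into one kernel-verified Lean document; each statement's English description precedes it below -/
import Mathlib

section
/- Let X be a countable metric space such that for some S > 0 and some positive integer N, every closed ball of radius S in X contains at most N points. Then X can be partitioned into at most N subsets X_1, …, X_k (k ≤ N, the X_i mutually disjoint with union X) such that for each i, any two distinct points x, x' ∈ X_i satisfy d(x, x') > S. -/
/-- Greedy colouring along a well-founded relation: if every point has fewer than `N` earlier
neighbours, then `N` colours suffice. -/
theorem exists_greedy_coloring {X : Type*} {r : X → X → Prop} (hr : WellFounded r) {N : ℕ}
    (A : X → Finset X) (hA : ∀ x, ∀ y ∈ A x, r y x) (hcard : ∀ x, (A x).card < N) :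
    ∃ c : X → Fin N, ∀ x, ∀ y ∈ A x, c y ≠ c x := by
  have free : ∀ (x : X) (g : ∀ y, r y x → Fin N),
      ∃ a : Fin N, ∀ y, ∀ hy : y ∈ A x, g y (hA x y hy) ≠ a := by
    intro x g
    obtain ⟨a, ha⟩ : ∃ a,
        a ∉ (A x).attach.image fun y : {y // y ∈ A x} => g y.1 (hA x y.1 y.2) := by
      by_contra! h
      have h₁ := Finset.card_le_card (fun a (_ : a ∈ Finset.univ) => h a)
      have h₂ := h₁.trans Finset.card_image_le
      rw [Finset.card_univ, Fintype.card_fin, Finset.card_attach] at h₂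
      exact (hcard x).not_ge h₂
    exact ⟨a, fun y hy h => ha (Finset.mem_image.2 ⟨⟨y, hy⟩, Finset.mem_attach _ _, h⟩)⟩
  choose pick hpick using free
  refine ⟨hr.fix pick, fun x y hy => ?_⟩
  rw [hr.fix_eq pick x]
  exact hpick x (fun y _ => hr.fix pick y) y hy



/-- A countable metric space in which every closed `S`-ball has at
most `N` points can be partitioned into at most `N` mutually disjoint
`S`-separated subsets. -/
theorem stmt_9 (X : Type*) [MetricSpace X] [Countable X]
    (S : ℝ) (hS : 0 < S) (N : ℕ) (hN : 0 < N)
    (hbg : ∀ (x : X) (F : Finset X), ↑F ⊆ Metric.closedBall x S → F.card ≤ N) :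
    ∃ (k : ℕ) (P : Fin k → Set X),
      k ≤ N ∧
      (∀ i j, i ≠ j → Disjoint (P i) (P j)) ∧
      (⋃ i, P i) = Set.univ ∧
      (∀ i, ∀ x ∈ P i, ∀ x' ∈ P i, x ≠ x' → S < dist x x') := by
  classical
  obtain ⟨e, he⟩ := exists_injective_nat X
  have hfin : ∀ x, {y | e y < e x ∧ dist y x ≤ S}.Finite := fun x =>
    ((Set.finite_Iio (e x)).preimage he.injOn).subset fun _ hy => hy.1
  obtain ⟨c, hc⟩ := exists_greedy_coloring (N := N) (InvImage.wf e wellFounded_lt)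
    (fun x => (hfin x).toFinset) (fun x y hy => ((hfin x).mem_toFinset.1 hy).1) (by
      intro x
      have hx : x ∉ (hfin x).toFinset := by simp
      rw [← Nat.succ_le_iff, Nat.succ_eq_add_one, ← Finset.card_insert_of_notMem hx]
      refine hbg x _ fun y hy => ?_
      rcases Finset.mem_insert.1 (Finset.mem_coe.1 hy) with rfl | hy
      · exact Metric.mem_closedBall_self hS.le
      · exact ((hfin x).mem_toFinset.1 hy).2)
  have key : ∀ x y, c x = c y → e y < e x → S < dist x y := by
    intro x y hxy hlt
    by_contra! h
    exact hc x y ((hfin x).mem_toFinset.2 ⟨hlt, dist_comm x y ▸ h⟩) hxy.symm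
  refine ⟨N, fun i => c ⁻¹' {i}, le_rfl, fun i j hij => ?_, ?_, ?_⟩
  · exact (Set.disjoint_singleton.2 hij).preimage c
  · exact Set.eq_univ_of_forall fun x => Set.mem_iUnion.2 ⟨c x, rfl⟩
  · intro i x hx y hy hne
    have hxy : c x = c y := Eq.trans hx (Eq.symm hy)
    rcases lt_or_gt_of_ne (he.ne hne) with h | h
    · rw [dist_comm]
      exact key y x hxy.symm h
    · exact key x y hxy h
end

section
/- Let (X_m)_{m ∈ ℕ} be a family of countable metric spaces with uniform bounded geometry: for every R ≥ 0 there is N_R such that for every m, every closed ball of radius R in X_m contains at most N_R points. Let (H_m)_{m ∈ ℕ} be real Hilbert spaces and f_m : X_m → H_m maps for which there exist common non-decreasing functions ρ₁, ρ₂ : [0,∞) → [0,∞) with ρ₁(t) → ∞ as t → ∞ and ρ₁(d(x,y)) ≤ ‖f_m(x) − f_m(y)‖ ≤ ρ₂(d(x,y)) for all m and all x, y ∈ X_m. Then for every r₀ > 0 there exists k₀ ∈ ℕ, independent of m, such that each X_m admits a partition into k₀ mutually disjoint subsets X_{m,1}, …, X_{m,k₀} with the property that for each k, any two distinct points x, x'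 ∈ X_{m,k} satisfy ‖f_m(x) − f_m(x')‖ > 3r₀. -/
/-- A simple graph on a countable vertex set in which every vertex has fewer than `N` neighbours
is `N`-colorable. -/
theorem SimpleGraph.colorable_of_forall_card_lt {V : Type*} [Countable V] (G : SimpleGraph V)
    (N : ℕ) (hN : ∀ v, ∀ F : Finset V, (∀ w ∈ F, G.Adj v w) → F.card < N) : G.Colorable N := by
  classical
  rcases isEmpty_or_nonempty V with hV | ⟨⟨v₀⟩⟩
  · exact SimpleGraph.Colorable.of_isEmpty N
  have : NeZero N := ⟨(Nat.zero_le _ |>.trans_lt (hN v₀ ∅ (by simp))).ne'⟩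
  obtain ⟨e, he⟩ := exists_injective_nat V
  let step (v : V) (ih : ∀ w, e w < e v → Fin N) : Fin N :=
    Classical.epsilon fun k => ∀ w (h : e w < e v), G.Adj v w → ih w h ≠ k
  let c : V → Fin N := (measure e).wf.fix step
  have hc (v w : V) (h : e w < e v) (hvw : G.Adj v w) : c w ≠ c v := by
    have hfin : {w | G.Adj v w ∧ e w < e v}.Finite :=
      ((Set.finite_Iio (e v)).preimage he.injOn).subset fun w hw => hw.2
    have hcard : (hfin.toFinset.image c).card < (Finset.univ : Finset (Fin N)).card := by
      rw [Finset.card_univ, Fintype.card_fin]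
      exact Finset.card_image_le.trans_lt (hN v _ fun w hw => (hfin.mem_toFinset.1 hw).1)
    obtain ⟨k, -, hk⟩ := Finset.exists_mem_notMem_of_card_lt_card hcard
    have hspec : ∀ w, e w < e v → G.Adj v w →
        c w ≠ Classical.epsilon fun k => ∀ w, e w < e v → G.Adj v w → c w ≠ k :=
      Classical.epsilon_spec (p := fun k => ∀ w, e w < e v → G.Adj v w → c w ≠ k)
        ⟨k, fun w h hvw hwk => hk (Finset.mem_image.2 ⟨w, hfin.mem_toFinset.2 ⟨hvw, h⟩, hwk⟩)⟩
    have hfix : c v = step v fun w _ => c w := (measure e).wf.fix_eq step v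
    rw [hfix]
    exact hspec w h hvw
  refine ⟨SimpleGraph.Coloring.mk c fun {v w} hvw => ?_⟩
  rcases lt_or_gt_of_ne (he.ne hvw.ne) with h | h
  · exact hc w v h hvw.symm
  · exact (hc v w h hvw).symm

/-- For a family of countable metric spaces with uniform bounded
geometry and maps into Hilbert spaces controlled by common non-decreasing
functions `ρ₁, ρ₂` with `ρ₁ → ∞`, for every `r₀ > 0` there is `k₀`, independent
of `m`, such that each `X_m` can be partitioned into `k₀` mutually disjoint
subsets on each of which distinct points `x, x'` satisfy `‖f_m x − f_m x'‖ > 3r₀`. -/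
theorem stmt_10 (X : ℕ → Type*) [∀ m, MetricSpace (X m)] [∀ m, Countable (X m)]
    (NR : ℝ → ℕ)
    (hbg : ∀ R : ℝ, 0 ≤ R → ∀ (m : ℕ) (x : X m) (F : Finset (X m)),
      ↑F ⊆ Metric.closedBall x R → F.card ≤ NR R)
    (H : ℕ → Type*) [∀ m, NormedAddCommGroup (H m)] [∀ m, InnerProductSpace ℝ (H m)]
    [∀ m, CompleteSpace (H m)]
    (f : ∀ m, X m → H m) (ρ₁ ρ₂ : ℝ → ℝ)
    (hρ₁ : Monotone ρ₁) (hρ₂ : Monotone ρ₂)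
    (hρ₁top : Filter.Tendsto ρ₁ Filter.atTop Filter.atTop)
    (hlow : ∀ (m : ℕ) (x y : X m), ρ₁ (dist x y) ≤ ‖f m x - f m y‖)
    (hup : ∀ (m : ℕ) (x y : X m), ‖f m x - f m y‖ ≤ ρ₂ (dist x y)) :
    ∀ r₀ : ℝ, 0 < r₀ → ∃ k₀ : ℕ, ∀ m : ℕ,
      ∃ P : Fin k₀ → Set (X m),
        (∀ i j, i ≠ j → Disjoint (P i) (P j)) ∧
        (⋃ i, P i) = Set.univ ∧
        (∀ k, ∀ x ∈ P k, ∀ x' ∈ P k, x ≠ x' → 3 * r₀ < ‖f m x - f m x'‖) := by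
  intro r₀ _
  obtain ⟨R, hR, hR0⟩ :=
    ((hρ₁top.eventually_gt_atTop (3 * r₀)).and (Filter.eventually_ge_atTop 0)).exists
  refine ⟨NR R, fun m => ?_⟩
  classical
  let G : SimpleGraph (X m) :=
    { Adj := fun x y => x ≠ y ∧ dist x y ≤ R
      symm := ⟨fun x y h => ⟨h.1.symm, dist_comm x y ▸ h.2⟩⟩
      loopless := ⟨fun x h => h.1 rfl⟩ }
  obtain ⟨c⟩ := G.colorable_of_forall_card_lt (NR R) fun x F hF => by
    have hx : x ∉ F := fun h => (hF x h).1 rfl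
    have hball : (↑(insert x F) : Set (X m)) ⊆ Metric.closedBall x R := by
      intro y hy
      rcases Finset.mem_insert.1 (Finset.mem_coe.1 hy) with rfl | hy
      · exact Metric.mem_closedBall_self hR0
      · exact Metric.mem_closedBall'.2 (hF y hy).2
    have hcard := hbg R hR0 m x _ hball
    rw [Finset.card_insert_of_notMem hx] at hcard
    exact hcard
  refine ⟨fun k => c ⁻¹' {k}, fun i j hij => ?_, ?_, fun k x hx y hy hxy => ?_⟩
  · exact (Set.disjoint_singleton.2 hij).preimage c
  · ext x
    simp
  · have hdist : R < dist x y := by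
      by_contra! h
      have hadj : G.Adj x y := ⟨hxy, h⟩
      exact c.valid hadj ((Set.mem_singleton_iff.1 hx).trans (Set.mem_singleton_iff.1 hy).symm)
    exact hR.trans_le ((hρ₁ hdist.le).trans (hlow m x y))
end

section
/- Consider C₀(ℝ, ℂ), the C*-algebra of continuous complex-valued functions on ℝ vanishing at infinity, with the supremum norm. The two functions s ↦ (s + i)⁻¹ and s ↦ (s − i)⁻¹ belong to C₀(ℝ, ℂ), and the closure of the (non-unital) subalgebra of C₀(ℝ, ℂ) generated by these two functions is all of C₀(ℝ, ℂ). -/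
open Filter Topology in
/-- Composition of a function on `s` vanishing at `0` with a `C₀` function taking values in `s`. -/
noncomputable def ContinuousMapZero.compZeroAtInfty {X : Type*} [TopologicalSpace X] {s : Set ℂ}
    [Fact (0 ∈ s)] (g : ZeroAtInftyContinuousMap X ℂ) (hg : ∀ x, g x ∈ s)
    (F : ContinuousMapZero s ℂ) : ZeroAtInftyContinuousMap X ℂ where
  toFun x := F ⟨g x, hg x⟩
  continuous_toFun := (map_continuous F).comp ((map_continuous g).subtype_mk hg)
  zero_at_infty' := by
    have h : Tendsto (fun x => (⟨g x, hg x⟩ : s)) (cocompact X) (𝓝 0) :=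
      tendsto_subtype_rng.2 (zero_at_infty g)
    simpa [Function.comp_def, map_zero] using ((map_continuous F).tendsto 0).comp h

lemma ContinuousMapZero.lipschitzWith_compZeroAtInfty {X : Type*} [TopologicalSpace X]
    {s : Set ℂ} [Fact (0 ∈ s)] [CompactSpace s] (g : ZeroAtInftyContinuousMap X ℂ)
    (hg : ∀ x, g x ∈ s) : LipschitzWith 1 (compZeroAtInfty (s := s) g hg) := by
  refine LipschitzWith.of_dist_le_mul fun F G => ?_
  rw [NNReal.coe_one, one_mul, ← ZeroAtInftyContinuousMap.dist_toBCF_eq_dist]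
  refine (BoundedContinuousFunction.dist_le dist_nonneg).2 fun x => ?_
  exact ContinuousMap.dist_apply_le_dist (f := (F : C(s, ℂ))) (g := (G : C(s, ℂ))) ⟨g x, hg x⟩

open Topology in
/-- Functions of `g` that vanish at `0` lie in the closed subalgebra generated by `g` and
`star g`. -/
lemma ContinuousMapZero.compZeroAtInfty_mem_topologicalClosure {X : Type*} [TopologicalSpace X]
    {s : Set ℂ} [Fact (0 ∈ s)] [CompactSpace s] (g : ZeroAtInftyContinuousMap X ℂ)
    (hg : ∀ x, g x ∈ s) (F : ContinuousMapZero s ℂ) :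
    F.compZeroAtInfty g hg ∈ (NonUnitalAlgebra.adjoin ℂ {g, star g}).topologicalClosure := by
  set A := (NonUnitalAlgebra.adjoin ℂ {g, star g}).topologicalClosure
  have hA : ∀ h ∈ ({g, star g} : Set (ZeroAtInftyContinuousMap X ℂ)), h ∈ A := fun h hh =>
    NonUnitalSubalgebra.le_topologicalClosure _ (NonUnitalAlgebra.subset_adjoin ℂ hh)
  induction F using ContinuousMapZero.induction_on_of_compact with
  | zero => exact A.zero_mem
  | id => exact hA g (by simp)
  | star_id => exact hA (star g) (by simp)
  | add F G hF hG => exact A.add_mem hF hG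
  | mul F G hF hG => exact A.mul_mem hF hG
  | smul r F hF => exact A.smul_mem' r hF
  | frequently F hF =>
    have hcl : IsClosed (compZeroAtInfty (s := s) g hg ⁻¹' A) :=
      (NonUnitalSubalgebra.isClosed_topologicalClosure _).preimage
        (lipschitzWith_compZeroAtInfty g hg).continuous
    exact hcl.closure_subset (mem_closure_iff_frequently.2 hF)

/-- The circle with diameter `[-i, 0]`, on which `s ↦ (s + i)⁻¹` takes its values. -/
abbrev resolventCircle : Set ℂ := Metric.sphere (-(Complex.I / 2)) (1 / 2)

lemma mem_resolventCircle_iff {z : ℂ} : z ∈ resolventCircle ↔ Complex.normSq z = -z.im := by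
  rw [mem_sphere_iff_norm, ← sq_eq_sq₀ (norm_nonneg _) (by norm_num), ← Complex.normSq_eq_norm_sq]
  simp only [Complex.normSq_apply, sub_neg_eq_add, Complex.add_re, Complex.add_im,
    Complex.div_ofNat_re, Complex.div_ofNat_im, Complex.I_re, Complex.I_im]
  constructor <;> intro h <;> linarith

instance : Fact ((0 : ℂ) ∈ resolventCircle) := ⟨by simp⟩

lemma ofReal_add_I_ne_zero (s : ℝ) : (s : ℂ) + Complex.I ≠ 0 := fun h => by
  simpa using congrArg Complex.im h

lemma inv_ofReal_add_I_mem_resolventCircle (s : ℝ) :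
    ((s : ℂ) + Complex.I)⁻¹ ∈ resolventCircle := by
  rw [mem_resolventCircle_iff]
  simp [Complex.inv_im, neg_div]

lemma inv_eq_of_mem_resolventCircle {z : ℂ} (hz : z ∈ resolventCircle) (h0 : z ≠ 0) :
    z⁻¹ = (z⁻¹.re : ℂ) + Complex.I := by
  have h : z⁻¹.im = 1 := by
    rw [Complex.inv_im, ← mem_resolventCircle_iff.1 hz, div_self (Complex.normSq_pos.2 h0).ne']
  apply Complex.ext <;> simp [h, -Complex.inv_re, -Complex.inv_im]

open scoped ContinuousMapZero in
open Filter Topology Bornology in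
lemma tendsto_inv_re_resolventCircle :
    Tendsto (fun z : resolventCircle => ((z : ℂ)⁻¹).re) (𝓝[≠] 0) (cocompact ℝ) := by
  have h1 : Tendsto (fun z : resolventCircle => (z : ℂ)) (𝓝[≠] 0) (𝓝[≠] 0) :=
    tendsto_nhdsWithin_of_tendsto_nhds_of_eventually_within _
      ((continuous_subtype_val.tendsto (0 : resolventCircle)).mono_left nhdsWithin_le_nhds)
      (eventually_mem_nhdsWithin.mono fun z hz h => hz (Subtype.ext h))
  have h2 := (tendsto_sub_const_cobounded Complex.I).comp (tendsto_inv₀_nhdsNE_zero.comp h1)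
  rw [← Metric.cobounded_eq_cocompact, ← tendsto_norm_atTop_iff_cobounded]
  refine (tendsto_norm_cobounded_atTop.comp h2).congr' ?_
  filter_upwards [eventually_mem_nhdsWithin] with z hz
  have h0 : (z : ℂ) ≠ 0 := fun h => hz (Subtype.ext h)
  rw [Function.comp_apply, Function.comp_apply, Function.comp_apply,
    inv_eq_of_mem_resolventCircle z.2 h0]
  simp

open scoped ContinuousMapZero in
open Filter Topology in
open scoped Classical in
/-- The transport of `f ∈ C₀(ℝ, ℂ)` to the circle along `s ↦ (s + i)⁻¹`. -/
noncomputable def ZeroAtInftyContinuousMap.toResolventCircle (f : ZeroAtInftyContinuousMap ℝ ℂ) :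
    ContinuousMapZero resolventCircle ℂ where
  toFun := Function.update (fun z : resolventCircle => f ((z : ℂ)⁻¹).re) 0 0
  continuous_toFun := by
    refine continuous_iff_continuousAt.2 fun z => ?_
    by_cases hz : z = 0
    · subst hz
      exact continuousAt_update_same.2 ((zero_at_infty f).comp tendsto_inv_re_resolventCircle)
    · have h0 : (z : ℂ) ≠ 0 := fun h => hz (Subtype.ext h)
      refine (continuousAt_update_of_ne hz).2 ?_
      exact (map_continuous f).continuousAt.comp
        (Complex.continuous_re.continuousAt.comp (continuousAt_subtype_val.inv₀ h0))
  map_zero' := by simp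

open scoped ContinuousMapZero in
lemma ZeroAtInftyContinuousMap.toResolventCircle_apply_of_ne_zero
    (f : ZeroAtInftyContinuousMap ℝ ℂ) {z : resolventCircle} (hz : z ≠ 0) :
    f.toResolventCircle z = f ((z : ℂ)⁻¹).re := by
  simp [toResolventCircle, hz, -Complex.inv_re]

open Filter Topology Bornology in
/-- The function `s ↦ (s + i)⁻¹` as an element of `C₀(ℝ, ℂ)`. -/
noncomputable def resolventZeroAtInfty : ZeroAtInftyContinuousMap ℝ ℂ where
  toFun s := ((s : ℂ) + Complex.I)⁻¹
  continuous_toFun := (by fun_prop : Continuous fun s : ℝ => (s : ℂ) + Complex.I).inv₀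
    ofReal_add_I_ne_zero
  zero_at_infty' := by
    rw [← Metric.cobounded_eq_cocompact]
    exact tendsto_inv₀_cobounded.comp ((tendsto_add_const_cobounded Complex.I).comp
      (RCLike.tendsto_ofReal_cobounded_cobounded ℂ))

open scoped ContinuousMapZero in
lemma compZeroAtInfty_toResolventCircle (f : ZeroAtInftyContinuousMap ℝ ℂ) :
    f.toResolventCircle.compZeroAtInfty resolventZeroAtInfty
      inv_ofReal_add_I_mem_resolventCircle = f := by
  ext s
  have h : (⟨resolventZeroAtInfty s, inv_ofReal_add_I_mem_resolventCircle s⟩ :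
      resolventCircle) ≠ 0 := fun h =>
    inv_ne_zero (ofReal_add_I_ne_zero s) (congrArg Subtype.val h)
  change f.toResolventCircle ⟨resolventZeroAtInfty s, _⟩ = f s
  rw [ZeroAtInftyContinuousMap.toResolventCircle_apply_of_ne_zero _ h]
  simp [resolventZeroAtInfty, -Complex.inv_re]

/-- In `C₀(ℝ, ℂ)`, the functions `s ↦ (s + i)⁻¹` and
`s ↦ (s − i)⁻¹` exist, and the closure of the (non-unital) subalgebra they
generate is all of `C₀(ℝ, ℂ)`. -/
theorem stmt_13 :
    ∃ g₁ g₂ : ZeroAtInftyContinuousMap ℝ ℂ,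
      (∀ s : ℝ, g₁ s = ((s : ℂ) + Complex.I)⁻¹) ∧
      (∀ s : ℝ, g₂ s = ((s : ℂ) - Complex.I)⁻¹) ∧
      closure ((NonUnitalAlgebra.adjoin ℂ {g₁, g₂} :
          NonUnitalSubalgebra ℂ (ZeroAtInftyContinuousMap ℝ ℂ)) :
        Set (ZeroAtInftyContinuousMap ℝ ℂ)) = Set.univ := by
  refine ⟨resolventZeroAtInfty, star resolventZeroAtInfty, fun s => rfl, fun s => ?_,
    Set.eq_univ_of_forall fun f => ?_⟩
  · simp [resolventZeroAtInfty, sub_eq_add_neg]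
  · have h := f.toResolventCircle.compZeroAtInfty_mem_topologicalClosure resolventZeroAtInfty
      inv_ofReal_add_I_mem_resolventCircle
    rwa [compZeroAtInfty_toResolventCircle] at h
end
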